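/- arXiv:2302.03125 — 2 statements merged into one kernel-verified Lean document; each statement's English description precedes it below -/
import Mathlib

section
/- Let σ₊, σ₋, θ > 0, set r = (1/σ₊ + 1/σ₋)/2, and let 0 < l < θt and x ≥ 0, y ≥ 0. Then ∫_{l/θ}^{t} h(t − τ, l/(2σ₋)) · h(τ − l/θ, (l/2 + x + y)/σ₊) dτ = h(t − l/θ, l·r + (x + y)/σ₊). -/
/-- First passage time density of Brownian motion started at `z`. -/
noncomputable def h (s z : ℝ) : ℝ :=
  z / (Real.sqrt (2 * Real.pi) * s ^ ((3 : ℝ) / 2)) * Real.exp (-z ^ 2 / (2 * s))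

/-- Argument of the Gaussian primitive in the convolution of two
first passage densities. -/
noncomputable def bridgeArg (T a c u : ℝ) : ℝ :=
  (a * u + c * (T - u)) / Real.sqrt (T * u * (T - u))

/-- The odd primitive of the unnormalised Gaussian density. -/
noncomputable def gaussPrimitive (z : ℝ) : ℝ :=
  ∫ s in (0 : ℝ)..z, Real.exp (-(1 / 2) * s ^ 2)

open Filter Topology MeasureTheory Set

theorem hasDerivAt_gaussPrimitive (z : ℝ) :
    HasDerivAt gaussPrimitive (Real.exp (-(1 / 2) * z ^ 2)) z := by
  have hc : Continuous fun s : ℝ => Real.exp (-(1 / 2) * s ^ 2) := by fun_prop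
  exact hc.integral_hasStrictDerivAt 0 z |>.hasDerivAt

theorem gaussPrimitive_neg (z : ℝ) : gaussPrimitive (-z) = -gaussPrimitive z := by
  have := intervalIntegral.integral_comp_neg (a := 0) (b := z)
    (fun s : ℝ => Real.exp (-(1 / 2) * s ^ 2))
  simp only [neg_sq, neg_zero] at this
  rw [gaussPrimitive, gaussPrimitive, this, intervalIntegral.integral_symm]

theorem tendsto_gaussPrimitive_atTop :
    Tendsto gaussPrimitive atTop (𝓝 (Real.sqrt (2 * Real.pi) / 2)) := by
  have := intervalIntegral_tendsto_integral_Ioi (0 : ℝ)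
    (integrable_exp_neg_mul_sq (b := 1 / 2) (by norm_num)).integrableOn tendsto_id
  rw [integral_gaussian_Ioi, show Real.pi / (1 / 2) = 2 * Real.pi by ring] at this
  exact this

theorem tendsto_gaussPrimitive_atBot :
    Tendsto gaussPrimitive atBot (𝓝 (-(Real.sqrt (2 * Real.pi) / 2))) := by
  refine ((tendsto_gaussPrimitive_atTop.comp tendsto_neg_atBot_atTop).neg).congr fun z => ?_
  simp [gaussPrimitive_neg]

theorem hasDerivAt_bridgeArg {T u : ℝ} (a c : ℝ) (hu : 0 < u) (huT : u < T) :
    HasDerivAt (bridgeArg T a c)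
      (T ^ 2 * (a * u - c * (T - u)) / (2 * (T * u * (T - u)) * Real.sqrt (T * u * (T - u)))) u := by
  have hTu : 0 < T - u := sub_pos.2 huT
  have hT : 0 < T := hu.trans huT
  have hp : 0 < T * u * (T - u) := by positivity
  have hs := Real.sqrt_pos.2 hp
  have hid := hasDerivAt_id u
  have hn := (hid.const_mul a).add ((hid.const_sub T).const_mul c)
  have hd := ((hid.const_mul T).mul (hid.const_sub T)).sqrt hp.ne'
  refine (hn.div hd hs.ne').congr_deriv ?_
  simp only [id, Pi.add_apply, Pi.mul_apply]
  have hsq := Real.sq_sqrt hp.le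
  set s := Real.sqrt (T * u * (T - u))
  rw [← hsq]
  field_simp
  rw [hsq]
  ring

theorem tendsto_inv_sqrt_bridge {T d : ℝ} {F : Filter ℝ} (hF : F ≤ 𝓝 d)
    (hd : T * d * (T - d) = 0) (hpos : ∀ᶠ u in F, 0 < T * u * (T - u)) :
    Tendsto (fun u => (Real.sqrt (T * u * (T - u)))⁻¹) F atTop := by
  refine tendsto_inv_nhdsGT_zero.comp (tendsto_nhdsWithin_iff.2 ⟨?_, ?_⟩)
  · have : Continuous fun u : ℝ => Real.sqrt (T * u * (T - u)) := by fun_prop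
    simpa [hd] using (this.tendsto d).mono_left hF
  · exact hpos.mono fun u hu => Real.sqrt_pos.2 hu

theorem tendsto_inv_sqrt_bridge_zero {T : ℝ} (hT : 0 < T) :
    Tendsto (fun u => (Real.sqrt (T * u * (T - u)))⁻¹) (𝓝[>] 0) atTop := by
  refine tendsto_inv_sqrt_bridge nhdsWithin_le_nhds (by simp) ?_
  filter_upwards [Ioo_mem_nhdsGT hT] with u hu
  exact mul_pos (mul_pos hT hu.1) (sub_pos.2 hu.2)

theorem tendsto_inv_sqrt_bridge_end {T : ℝ} (hT : 0 < T) :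
    Tendsto (fun u => (Real.sqrt (T * u * (T - u)))⁻¹) (𝓝[<] T) atTop := by
  refine tendsto_inv_sqrt_bridge nhdsWithin_le_nhds (by simp) ?_
  filter_upwards [Ioo_mem_nhdsLT hT] with u hu
  exact mul_pos (mul_pos hT hu.1) (sub_pos.2 hu.2)

theorem tendsto_bridgeArg_numerator (T a c d : ℝ) (s : Set ℝ) :
    Tendsto (fun u => a * u + c * (T - u)) (𝓝[s] d) (𝓝 (a * d + c * (T - d))) :=
  (Continuous.tendsto (by fun_prop) d).mono_left nhdsWithin_le_nhds

theorem tendsto_bridgeArg_zero_atTop {T c : ℝ} (a : ℝ) (hT : 0 < T) (hc : 0 < c) :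
    Tendsto (bridgeArg T a c) (𝓝[>] 0) atTop :=
  (tendsto_bridgeArg_numerator T a c 0 _).pos_mul_atTop (by simp; positivity)
    (tendsto_inv_sqrt_bridge_zero hT)

theorem tendsto_bridgeArg_zero_atBot {T c : ℝ} (a : ℝ) (hT : 0 < T) (hc : c < 0) :
    Tendsto (bridgeArg T a c) (𝓝[>] 0) atBot :=
  (tendsto_bridgeArg_numerator T a c 0 _).neg_mul_atTop (by simpa using mul_neg_of_neg_of_pos hc hT)
    (tendsto_inv_sqrt_bridge_zero hT)

theorem tendsto_bridgeArg_end {T a : ℝ} (c : ℝ) (hT : 0 < T) (ha : 0 < a) :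
    Tendsto (bridgeArg T a c) (𝓝[<] T) atTop :=
  (tendsto_bridgeArg_numerator T a c T _).pos_mul_atTop (by simp; positivity)
    (tendsto_inv_sqrt_bridge_end hT)

theorem bridgeArg_sq {T u : ℝ} (a c : ℝ) (hu : 0 < u) (huT : u < T) :
    bridgeArg T a c u ^ 2 = (a * u + c * (T - u)) ^ 2 / (T * u * (T - u)) := by
  have : 0 < T - u := sub_pos.2 huT
  have hT : 0 < T := hu.trans huT
  rw [bridgeArg, div_pow, Real.sq_sqrt (by positivity)]

theorem rpow_three_halves {s : ℝ} (hs : 0 < s) : s ^ ((3 : ℝ) / 2) = s * Real.sqrt s := by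
  rw [Real.sqrt_eq_rpow, ← Real.rpow_one_add' hs.le (by norm_num)]
  norm_num

theorem h_nonneg {s z : ℝ} (hs : 0 ≤ s) (hz : 0 ≤ z) : 0 ≤ h s z := by
  unfold h; positivity

/-- A primitive of the convolution integrand of two first passage densities. -/
noncomputable def convPrimitive (T a b u : ℝ) : ℝ :=
  a * b / (2 * Real.pi) * Real.exp (-(a + b) ^ 2 / (2 * T)) / (T * Real.sqrt T) *
    ((1 / a + 1 / b) * gaussPrimitive (bridgeArg T a (-b) u) +
      (1 / a - 1 / b) * Real.exp (2 * a * b / T) * gaussPrimitive (bridgeArg T a b u))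

theorem hasDerivAt_convPrimitive {T a b u : ℝ} (ha : 0 < a) (hb : 0 < b) (hu : 0 < u)
    (huT : u < T) :
    HasDerivAt (convPrimitive T a b) (h (T - u) a * h u b) u := by
  have hTu : 0 < T - u := sub_pos.2 huT
  have hT : 0 < T := hu.trans huT
  have hw := (hasDerivAt_gaussPrimitive _).comp u (hasDerivAt_bridgeArg a (-b) hu huT)
  have hv := (hasDerivAt_gaussPrimitive _).comp u (hasDerivAt_bridgeArg a b hu huT)
  refine (((hw.const_mul (1 / a + 1 / b)).add
    (hv.const_mul ((1 / a - 1 / b) * Real.exp (2 * a * b / T)))).const_mul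
    (a * b / (2 * Real.pi) * Real.exp (-(a + b) ^ 2 / (2 * T)) / (T * Real.sqrt T))).congr_deriv ?_
  have hE : Real.exp (-(1 / 2) * bridgeArg T a (-b) u ^ 2) =
      Real.exp (2 * a * b / T) * Real.exp (-(1 / 2) * bridgeArg T a b u ^ 2) := by
    rw [← Real.exp_add, bridgeArg_sq _ _ hu huT, bridgeArg_sq _ _ hu huT]
    congr 1
    field_simp
    ring
  have hX : Real.exp (-a ^ 2 / (2 * (T - u))) * Real.exp (-b ^ 2 / (2 * u)) =
      Real.exp (-(a + b) ^ 2 / (2 * T)) *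
        (Real.exp (2 * a * b / T) * Real.exp (-(1 / 2) * bridgeArg T a b u ^ 2)) := by
    rw [← hE, ← Real.exp_add, ← Real.exp_add, bridgeArg_sq _ _ hu huT]
    congr 1
    field_simp
    ring
  have hh : h (T - u) a * h u b = a * b / (Real.sqrt (2 * Real.pi) ^ 2 *
      ((T - u) * Real.sqrt (T - u)) * (u * Real.sqrt u)) *
      (Real.exp (-a ^ 2 / (2 * (T - u))) * Real.exp (-b ^ 2 / (2 * u))) := by
    rw [h, h, rpow_three_halves hu, rpow_three_halves hTu]
    generalize T - u = v
    ring
  rw [hh, hX, hE, Real.sq_sqrt (by positivity), Real.sqrt_mul (by positivity),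
    Real.sqrt_mul hT.le]
  have h1 := Real.sqrt_pos.2 hu
  have h2 := Real.sqrt_pos.2 hTu
  have h3 := Real.sqrt_pos.2 hT
  have hsq := Real.sq_sqrt hT.le
  generalize Real.exp (2 * a * b / T) = E1
  generalize Real.exp (-(1 / 2) * bridgeArg T a b u ^ 2) = E2
  generalize Real.exp (-(a + b) ^ 2 / (2 * T)) = E3
  set r := Real.sqrt T
  field_simp
  rw [hsq]
  ring

theorem tendsto_convPrimitive_zero {T a b : ℝ} (hT : 0 < T) (hb : 0 < b) :
    Tendsto (convPrimitive T a b) (𝓝[>] 0)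
      (𝓝 (a * b / (2 * Real.pi) * Real.exp (-(a + b) ^ 2 / (2 * T)) / (T * Real.sqrt T) *
        ((1 / a + 1 / b) * -(Real.sqrt (2 * Real.pi) / 2) +
          (1 / a - 1 / b) * Real.exp (2 * a * b / T) * (Real.sqrt (2 * Real.pi) / 2)))) :=
  (((tendsto_gaussPrimitive_atBot.comp
    (tendsto_bridgeArg_zero_atBot a hT (neg_lt_zero.2 hb))).const_mul _).add
    ((tendsto_gaussPrimitive_atTop.comp
      (tendsto_bridgeArg_zero_atTop a hT hb)).const_mul _)).const_mul _

theorem tendsto_convPrimitive_end {T a b : ℝ} (hT : 0 < T) (ha : 0 < a) :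
    Tendsto (convPrimitive T a b) (𝓝[<] T)
      (𝓝 (a * b / (2 * Real.pi) * Real.exp (-(a + b) ^ 2 / (2 * T)) / (T * Real.sqrt T) *
        ((1 / a + 1 / b) * (Real.sqrt (2 * Real.pi) / 2) +
          (1 / a - 1 / b) * Real.exp (2 * a * b / T) * (Real.sqrt (2 * Real.pi) / 2)))) :=
  (((tendsto_gaussPrimitive_atTop.comp
    (tendsto_bridgeArg_end (-b) hT ha)).const_mul _).add
    ((tendsto_gaussPrimitive_atTop.comp
      (tendsto_bridgeArg_end b hT ha)).const_mul _)).const_mul _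

/-- A nonnegative derivative of a function with finite one-sided limits at the endpoints is
interval integrable. -/
theorem intervalIntegrable_of_hasDerivAt_of_tendsto_of_nonneg {f f' : ℝ → ℝ} {a b fa fb : ℝ}
    (hab : a < b) (hderiv : ∀ x ∈ Ioo a b, HasDerivAt f (f' x) x)
    (hnonneg : ∀ x ∈ Ioo a b, 0 ≤ f' x) (ha : Tendsto f (𝓝[>] a) (𝓝 fa))
    (hb : Tendsto f (𝓝[<] b) (𝓝 fb)) : IntervalIntegrable f' volume a b := by
  have hc : ContinuousOn f (Ioo a b) := fun x hx => (hderiv x hx).continuousAt.continuousWithinAt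
  refine (intervalIntegrable_iff_integrableOn_Ioc_of_le hab.le).2
    (intervalIntegral.integrableOn_deriv_of_nonneg
      (continuousOn_Icc_extendFrom_Ioo hc ha hb) (fun x hx => ?_) hnonneg)
  refine (hderiv x hx).congr_of_eventuallyEq ?_
  filter_upwards [isOpen_Ioo.mem_nhds hx] with y hy
  exact extendFrom_eq (subset_closure hy) ((hc y hy))

/-- Convolution semigroup property of the first passage densities. -/
theorem integral_h_mul_h {T a b : ℝ} (hT : 0 < T) (ha : 0 < a) (hb : 0 < b) :
    ∫ u in (0 : ℝ)..T, h (T - u) a * h u b = h T (a + b) := by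
  have hderiv : ∀ u ∈ Ioo 0 T, HasDerivAt (convPrimitive T a b) (h (T - u) a * h u b) u :=
    fun u hu => hasDerivAt_convPrimitive ha hb hu.1 hu.2
  have h0 := tendsto_convPrimitive_zero (a := a) hT hb
  have h1 := tendsto_convPrimitive_end (b := b) hT ha
  have hint := intervalIntegrable_of_hasDerivAt_of_tendsto_of_nonneg hT hderiv
    (fun u hu => mul_nonneg (h_nonneg (sub_pos.2 hu.2).le ha.le) (h_nonneg hu.1.le hb.le)) h0 h1
  rw [intervalIntegral.integral_eq_sub_of_hasDerivAt_of_tendsto hT hderiv hint h0 h1, h,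
    rpow_three_halves hT]
  have hpi : 2 * Real.pi = Real.sqrt (2 * Real.pi) ^ 2 := (Real.sq_sqrt (by positivity)).symm
  have hq : 0 < Real.sqrt (2 * Real.pi) := by positivity
  have h3 := Real.sqrt_pos.2 hT
  generalize Real.sqrt (2 * Real.pi) = q at hpi hq ⊢
  rw [hpi]
  field_simp
  ring

/-- Integrating the trivariate density over the occupation time variable
(Corollary 3.3, case `x ≥ 0`, `y > 0`). -/
theorem trivariate_marginal_tau (σp σm θ l t x y : ℝ) (hσp : 0 < σp)
    (hσm : 0 < σm) (hθ : 0 < θ) (hl : 0 < l) (hlt : l < θ * t)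
    (hx : 0 ≤ x) (hy : 0 ≤ y) :
    let r := (1 / σp + 1 / σm) / 2
    ∫ τ in (l / θ)..t,
        h (t - τ) (l / (2 * σm)) * h (τ - l / θ) ((l / 2 + x + y) / σp) =
      h (t - l / θ) (l * r + (x + y) / σp) := by
  intro r
  have hT : 0 < t - l / θ := sub_pos.2 ((div_lt_iff₀' hθ).2 hlt)
  have key := integral_h_mul_h hT (a := l / (2 * σm)) (b := (l / 2 + x + y) / σp)
    (by positivity) (by positivity)
  have hz : l / (2 * σm) + (l / 2 + x + y) / σp = l * r + (x + y) / σp := by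
    simp only [r]
    field_simp
    ring
  have hshift := intervalIntegral.integral_comp_sub_right (a := l / θ) (b := t)
    (fun u => h (t - l / θ - u) (l / (2 * σm)) * h u ((l / 2 + x + y) / σp)) (l / θ)
  simp only [sub_self, sub_sub_sub_cancel_right] at hshift
  rw [hshift, key, hz]
end

section
/- Let r > 0 and θ > 0, and define g(t, z) = θ · exp(2rθz + 2r²θ²t) · erfc(z/√(2t) + rθ·√(2t)) for t > 0 and z ≥ 0. Then for every t > 0, θ^{−1}·g(t, 0) + 2r · ∫_0^∞ g(t, u) du = 1. -/
/-- The complementary error function. -/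
noncomputable def erfc (x : ℝ) : ℝ :=
  (2 / Real.sqrt Real.pi) * ∫ u in Set.Ioi x, Real.exp (-u ^ 2)

/-- The kernel of the transition function of the oscillating sticky Brownian motion
(Proposition 2.4, with corrected exponent). -/
noncomputable def g (r θ t z : ℝ) : ℝ :=
  θ * Real.exp (2 * r * θ * z + 2 * r ^ 2 * θ ^ 2 * t) *
    erfc (z / Real.sqrt (2 * t) + r * θ * Real.sqrt (2 * t))

theorem integrable_exp_neg_sq : MeasureTheory.Integrable fun u : ℝ => Real.exp (-u ^ 2) := by
  simpa using integrable_exp_neg_mul_sq one_pos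

theorem erfc_zero : erfc 0 = 1 := by
  have h := integral_gaussian_Ioi 1
  simp only [neg_mul, one_mul, div_one] at h
  rw [erfc, h]
  field_simp

theorem erfc_nonneg (x : ℝ) : 0 ≤ erfc x :=
  mul_nonneg (by positivity) (MeasureTheory.integral_nonneg fun _ => (Real.exp_pos _).le)

theorem hasDerivAt_erfc (x : ℝ) :
    HasDerivAt erfc (-(2 / √Real.pi * Real.exp (-x ^ 2))) x := by
  have hsplit : erfc = fun y => 2 / √Real.pi *
      ((∫ u in Set.Ioi (0 : ℝ), Real.exp (-u ^ 2)) - ∫ u in (0 : ℝ)..y, Real.exp (-u ^ 2)) := by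
    funext y
    rw [erfc, ← intervalIntegral.integral_Ioi_sub_Ioi'
      integrable_exp_neg_sq.integrableOn integrable_exp_neg_sq.integrableOn, sub_sub_cancel]
  have hcont : Continuous fun u : ℝ => Real.exp (-u ^ 2) := by fun_prop
  have hd := intervalIntegral.integral_hasDerivAt_right (hcont.intervalIntegrable 0 x)
    (hcont.stronglyMeasurableAtFilter _ _) hcont.continuousAt
  rw [hsplit]
  simpa using (hd.const_sub _).const_mul (2 / √Real.pi)

theorem erfc_le_exp_neg_sq {x : ℝ} (hx : 0 ≤ x) : erfc x ≤ Real.exp (-x ^ 2) := by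
  have hshift : ∫ u in Set.Ioi x, Real.exp (-u ^ 2) =
      ∫ v in Set.Ioi (0 : ℝ), Real.exp (-(v + x) ^ 2) := by
    simpa using ((MeasureTheory.measurePreserving_add_right MeasureTheory.volume
      x).setIntegral_preimage_emb (measurableEmbedding_addRight x)
      (fun u => Real.exp (-u ^ 2)) (Set.Ioi x)).symm
  have hle : ∫ v in Set.Ioi (0 : ℝ), Real.exp (-(v + x) ^ 2) ≤
      ∫ v in Set.Ioi (0 : ℝ), Real.exp (-x ^ 2) * Real.exp (-v ^ 2) := by
    refine MeasureTheory.setIntegral_mono_on (integrable_exp_neg_sq.comp_add_right x).integrableOn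
      (integrable_exp_neg_sq.const_mul _).integrableOn measurableSet_Ioi fun v hv => ?_
    rw [← Real.exp_add, Real.exp_le_exp]
    nlinarith [mul_nonneg hx (Set.mem_Ioi.mp hv).le]
  calc erfc x ≤ 2 / √Real.pi * ∫ v in Set.Ioi (0 : ℝ), Real.exp (-x ^ 2) * Real.exp (-v ^ 2) := by
        rw [erfc, hshift]
        gcongr
    _ = Real.exp (-x ^ 2) * erfc 0 := by
        rw [MeasureTheory.integral_const_mul, erfc]
        ring
    _ = Real.exp (-x ^ 2) := by rw [erfc_zero, mul_one]

theorem exp_mul_exp_neg_sq_shift (a z : ℝ) {s : ℝ} (hs : s ≠ 0) :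
    Real.exp (2 * a * z + a ^ 2 * s ^ 2) * Real.exp (-(z / s + a * s) ^ 2) =
      Real.exp (-(z / s) ^ 2) := by
  rw [← Real.exp_add]
  congr 1
  field_simp
  ring

theorem tendsto_exp_neg_div_sq {s : ℝ} (hs : 0 < s) :
    Filter.Tendsto (fun z => Real.exp (-(z / s) ^ 2)) Filter.atTop (nhds 0) :=
  Real.tendsto_exp_neg_atTop_nhds_zero.comp <|
    (Filter.tendsto_pow_atTop two_ne_zero).comp (Filter.tendsto_id.atTop_div_const hs)

theorem hasDerivAt_exp_mul_erfc_sub_erfc (a z : ℝ) {s : ℝ} (hs : s ≠ 0) :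
    HasDerivAt
      (fun z => Real.exp (2 * a * z + a ^ 2 * s ^ 2) * erfc (z / s + a * s) - erfc (z / s))
      (2 * a * (Real.exp (2 * a * z + a ^ 2 * s ^ 2) * erfc (z / s + a * s))) z := by
  have hdiv : HasDerivAt (fun z : ℝ => z / s) (1 / s) z := (hasDerivAt_id z).div_const s
  have hexp := (((hasDerivAt_id z).const_mul (2 * a)).add_const (a ^ 2 * s ^ 2)).exp
  have hshift := (hasDerivAt_erfc (z / s + a * s)).comp z (hdiv.add_const (a * s))
  have h := (hexp.mul hshift).sub ((hasDerivAt_erfc (z / s)).comp z hdiv)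
  refine h.congr_deriv ?_
  simp only [id, Function.comp_apply]
  rw [← exp_mul_exp_neg_sq_shift a z hs]
  ring

theorem tendsto_exp_mul_erfc_sub_erfc {a s : ℝ} (ha : 0 ≤ a) (hs : 0 < s) :
    Filter.Tendsto
      (fun z => Real.exp (2 * a * z + a ^ 2 * s ^ 2) * erfc (z / s + a * s) - erfc (z / s))
      Filter.atTop (nhds 0) := by
  have hlim := tendsto_exp_neg_div_sq hs
  rw [← sub_zero (0 : ℝ)]
  refine Filter.Tendsto.sub (squeeze_zero' ?_ ?_ hlim) (squeeze_zero' ?_ ?_ hlim)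
  · exact .of_forall fun z => mul_nonneg (Real.exp_pos _).le (erfc_nonneg _)
  · filter_upwards [Filter.eventually_ge_atTop 0] with z hz
    rw [← exp_mul_exp_neg_sq_shift a z hs.ne']
    gcongr
    exact erfc_le_exp_neg_sq (by positivity)
  · exact .of_forall fun z => erfc_nonneg _
  · filter_upwards [Filter.eventually_ge_atTop 0] with z hz
    exact erfc_le_exp_neg_sq (by positivity)

theorem integral_exp_mul_erfc {a s : ℝ} (ha : 0 ≤ a) (hs : 0 < s) :
    ∫ z in Set.Ioi (0 : ℝ),
        2 * a * (Real.exp (2 * a * z + a ^ 2 * s ^ 2) * erfc (z / s + a * s)) =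
      1 - Real.exp (a ^ 2 * s ^ 2) * erfc (a * s) := by
  rw [MeasureTheory.integral_Ioi_of_hasDerivAt_of_nonneg'
    (fun z _ => hasDerivAt_exp_mul_erfc_sub_erfc a z hs.ne')
    (fun z _ => mul_nonneg (by positivity) (mul_nonneg (Real.exp_pos _).le (erfc_nonneg _)))
    (tendsto_exp_mul_erfc_sub_erfc ha hs)]
  simp [erfc_zero]

/-- The transition kernel of the OSBM started at `0` is a probability measure. -/
theorem g_total_mass_one (r θ : ℝ) (hr : 0 < r) (hθ : 0 < θ) (t : ℝ) (ht : 0 < t) :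
    θ⁻¹ * g r θ t 0 + 2 * r * ∫ u in Set.Ioi (0 : ℝ), g r θ t u = 1 := by
  have hs : 0 < √(2 * t) := by positivity
  have hg (z : ℝ) : g r θ t z =
      θ * (Real.exp (2 * (r * θ) * z + (r * θ) ^ 2 * √(2 * t) ^ 2) *
        erfc (z / √(2 * t) + r * θ * √(2 * t))) := by
    rw [g, Real.sq_sqrt (by positivity), mul_assoc]
    ring_nf
  have hint : 2 * r * ∫ u in Set.Ioi (0 : ℝ), g r θ t u =
      1 - Real.exp ((r * θ) ^ 2 * √(2 * t) ^ 2) * erfc (r * θ * √(2 * t)) := by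
    rw [← integral_exp_mul_erfc (mul_pos hr hθ).le hs, ← MeasureTheory.integral_const_mul]
    congr 1 with z
    rw [hg]
    ring
  rw [hint, hg, inv_mul_cancel_left₀ hθ.ne']
  simp
end
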